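/- arXiv:2112.06706 — 9 statements merged into one kernel-verified Lean document; each statement's English description precedes it below -/
import Mathlib

section
/- For all (t,x) ∈ [0,T]×ℝ, the function V¹ satisfies ∂_x V¹(t,x) > 0 and ∂_{xx} V¹(t,x) < 0, the terminal condition V¹(T,x) = -(1/m)e^{-mx}, and the reduced Hamilton–Jacobi–Bellman equation ∂_t V¹(t,x) + (r x - δ - ρ)·∂_x V¹(t,x) - (μ²/(2σ²))·(∂_x V¹(t,x))² / ∂_{xx} V¹(t,x) = 0. -/
/-- The derivative of a multiple of the exponential of an affine function,
`x ↦ a * exp (b * x + c)`. -/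
theorem deriv_const_mul_exp_affine (a b c : ℝ) :
    deriv (fun y : ℝ => a * Real.exp (b * y + c)) =
      fun y => a * b * Real.exp (b * y + c) := by
  funext y
  have h : HasDerivAt (fun y : ℝ => b * y + c) b y := by
    simpa using ((hasDerivAt_id y).const_mul b).add_const c
  rw [(h.exp.const_mul a).deriv]
  ring

/-- Properties of the post-expansion value function `V¹`:
positivity of `∂ₓV¹`, strict concavity `∂ₓₓV¹ < 0`, the terminal condition, and the
reduced HJB equation. -/
theorem stmt_0
    (r μ σ m T δ ρ : ℝ)
    (hr : 0 < r) (hμ : 0 < μ) (hσ : 0 < σ) (hm : 0 < m) (hT : 0 < T)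
    (hδ : 0 ≤ δ) (hρ : 0 ≤ ρ)
    (d g : ℝ → ℝ) (V1 : ℝ → ℝ → ℝ)
    (hd : ∀ t, d t = -((δ + ρ) * m / r) * (1 - Real.exp (-(r * (T - t)))))
    (hg : ∀ t, g t = -(μ ^ 2 / (2 * σ ^ 2)) * (T - t))
    (hV1 : ∀ t x, V1 t x =
      -(1 / m) * Real.exp ((-(m * x) - d t) * Real.exp (r * (T - t)) + g t)) :
    ∀ t ∈ Set.Icc (0 : ℝ) T, ∀ x : ℝ,
      0 < deriv (fun y => V1 t y) x ∧
      deriv (deriv (fun y => V1 t y)) x < 0 ∧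
      V1 T x = -(1 / m) * Real.exp (-(m * x)) ∧
      deriv (fun s => V1 s x) t
        + (r * x - δ - ρ) * deriv (fun y => V1 t y) x
        - (μ ^ 2 / (2 * σ ^ 2)) * (deriv (fun y => V1 t y) x) ^ 2
            / deriv (deriv (fun y => V1 t y)) x = 0 := by
  have hV : ∀ t x, V1 t x = -(1 / m) * Real.exp (-(m * Real.exp (r * (T - t))) * x +
      ((δ + ρ) * m / r * (Real.exp (r * (T - t)) - 1) - μ ^ 2 / (2 * σ ^ 2) * (T - t))) := by
    intro t x
    have hE : Real.exp (-(r * (T - t))) * Real.exp (r * (T - t)) = 1 := by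
      rw [← Real.exp_add, neg_add_cancel, Real.exp_zero]
    rw [hV1, hd, hg]
    congr 2
    linear_combination -((δ + ρ) * m / r) * hE
  intro t _ x
  have hterm : V1 T x = -(1 / m) * Real.exp (-(m * x)) := by
    rw [hV]
    simp
  have htime : deriv (fun s => V1 s x) t =
      V1 t x * (m * Real.exp (r * (T - t)) * (r * x - δ - ρ) + μ ^ 2 / (2 * σ ^ 2)) := by
    have hsub : HasDerivAt (fun s : ℝ => T - s) (-1) t := by
      simpa using (hasDerivAt_id t).const_sub T
    have hE := (hsub.const_mul r).exp
    have h := ((((hE.const_mul m).neg.mul_const x).add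
      (((hE.sub_const 1).const_mul ((δ + ρ) * m / r)).sub
        (hsub.const_mul (μ ^ 2 / (2 * σ ^ 2))))).exp).const_mul (-(1 / m))
    have hfun : (fun s => V1 s x) = _ := funext fun s => hV s x
    rw [hfun, hV]
    refine h.deriv.trans ?_
    simp only [Pi.add_apply, Pi.sub_apply, Pi.neg_apply]
    field_simp
    ring
  have hspace : (fun y => V1 t y) = _ := funext fun y => hV t y
  have hx : deriv (fun y => V1 t y) x = -(m * Real.exp (r * (T - t))) * V1 t x := by
    rw [hspace, deriv_const_mul_exp_affine, hV]
    ring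
  have hxx : deriv (deriv (fun y => V1 t y)) x =
      (m * Real.exp (r * (T - t))) ^ 2 * V1 t x := by
    rw [hspace, deriv_const_mul_exp_affine, deriv_const_mul_exp_affine, hV]
    ring
  have hneg : V1 t x < 0 := by
    rw [hV1]
    exact mul_neg_of_neg_of_pos (neg_neg_of_pos (by positivity)) (Real.exp_pos _)
  have hpos : 0 < m * Real.exp (r * (T - t)) := by positivity
  rw [htime, hx, hxx]
  refine ⟨mul_pos_of_neg_of_neg (neg_neg_of_pos hpos) hneg,
    mul_neg_of_pos_of_neg (pow_pos hpos 2) hneg, hterm, ?_⟩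
  have hne := hneg.ne
  field_simp
  ring
end

section
/- For all (t,x) ∈ [0,T]×ℝ, the supremum over f ∈ [0,∞) of (1/2)σ²f²·∂_{xx}V¹(t,x) + (r x + μ f - δ - ρ)·∂_x V¹(t,x) is attained at f = f¹(t) = (μ/(σ²m))·e^{-r(T-t)}, and the Hamilton–Jacobi–Bellman equation ∂_t V¹(t,x) + sup_{f ∈ [0,∞)} [ (1/2)σ²f²·∂_{xx}V¹(t,x) + (r x + μ f - δ - ρ)·∂_x V¹(t,x) ] = 0 holds. -/
/-- A concave quadratic function attains its maximum over `[0, ∞)`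
at its vertex, when the vertex is nonnegative. -/
theorem isGreatest_image_Ici_of_vertex {a b c v : ℝ} (ha : a ≤ 0) (hv : 0 ≤ v)
    (hb : b = -(2 * a * v)) :
    IsGreatest ((fun f : ℝ => a * f ^ 2 + b * f + c) '' Set.Ici 0) (a * v ^ 2 + b * v + c) := by
  refine ⟨⟨v, hv, rfl⟩, ?_⟩
  rintro _ ⟨f, -, rfl⟩
  subst hb
  nlinarith [mul_nonneg (neg_nonneg.2 ha) (sq_nonneg (f - v))]


/-- The supremum over `f ∈ [0,∞)` of the Hamiltonian is attained at
`f¹(t) = (μ/(σ²m))·e^{-r(T-t)}`, and the HJB equation for `V¹` holds. -/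
theorem stmt_1
    (r μ σ m T δ ρ : ℝ)
    (hr : 0 < r) (hμ : 0 < μ) (hσ : 0 < σ) (hm : 0 < m) (hT : 0 < T)
    (hδ : 0 ≤ δ) (hρ : 0 ≤ ρ)
    (d g : ℝ → ℝ) (V1 : ℝ → ℝ → ℝ) (f1 : ℝ → ℝ)
    (hd : ∀ t, d t = -((δ + ρ) * m / r) * (1 - Real.exp (-(r * (T - t)))))
    (hg : ∀ t, g t = -(μ ^ 2 / (2 * σ ^ 2)) * (T - t))
    (hV1 : ∀ t x, V1 t x =
      -(1 / m) * Real.exp ((-(m * x) - d t) * Real.exp (r * (T - t)) + g t))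
    (hf1 : ∀ t, f1 t = (μ / (σ ^ 2 * m)) * Real.exp (-(r * (T - t)))) :
    ∀ t ∈ Set.Icc (0 : ℝ) T, ∀ x : ℝ,
      IsGreatest
        ((fun f => (1 / 2) * σ ^ 2 * f ^ 2 * deriv (deriv (fun y => V1 t y)) x
            + (r * x + μ * f - δ - ρ) * deriv (fun y => V1 t y) x) '' Set.Ici 0)
        ((1 / 2) * σ ^ 2 * (f1 t) ^ 2 * deriv (deriv (fun y => V1 t y)) x
            + (r * x + μ * (f1 t) - δ - ρ) * deriv (fun y => V1 t y) x) ∧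
      deriv (fun s => V1 s x) t
        + sSup ((fun f => (1 / 2) * σ ^ 2 * f ^ 2 * deriv (deriv (fun y => V1 t y)) x
            + (r * x + μ * f - δ - ρ) * deriv (fun y => V1 t y) x) '' Set.Ici 0) = 0 := by
  intro t _ x
  obtain rfl : d = _ := funext hd
  obtain rfl : g = _ := funext hg
  obtain rfl : f1 = _ := funext hf1
  obtain rfl : V1 = _ := funext fun t => funext (hV1 t)
  clear hd hg hf1 hV1
  beta_reduce
  set A := Real.exp (r * (T - t)) with hA
  set B := Real.exp (-(r * (T - t))) with hB
  have hAB : A * B = 1 := by rw [hA, hB, ← Real.exp_add, add_neg_cancel, Real.exp_zero]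
  have hApos : 0 < A := Real.exp_pos _
  have hBpos : 0 < B := Real.exp_pos _
  set D := -((δ + ρ) * m / r) * (1 - B) with hD
  set G := -(μ ^ 2 / (2 * σ ^ 2)) * (T - t) with hG
  have hE (y : ℝ) : HasDerivAt (fun y => Real.exp ((-(m * y) - D) * A + G))
      (-(m * A) * Real.exp ((-(m * y) - D) * A + G)) y := by
    have h := (((((hasDerivAt_id y).const_mul m).fun_neg.sub_const D).mul_const A).add_const G).exp
    exact h.congr_deriv (by simp only [id]; ring)
  have hVx : deriv (fun y => -(1 / m) * Real.exp ((-(m * y) - D) * A + G))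
      = fun y => A * Real.exp ((-(m * y) - D) * A + G) := by
    funext y
    rw [((hE y).const_mul (-(1 / m))).deriv]
    field_simp
  have hVxx : deriv (fun y => A * Real.exp ((-(m * y) - D) * A + G)) x
      = -(m * A ^ 2) * Real.exp ((-(m * x) - D) * A + G) := by
    rw [((hE x).const_mul A).deriv]
    ring
  have hVt : deriv (fun s => -(1 / m) * Real.exp
        ((-(m * x) - -((δ + ρ) * m / r) * (1 - Real.exp (-(r * (T - s))))) * Real.exp (r * (T - s))
          + -(μ ^ 2 / (2 * σ ^ 2)) * (T - s))) t
      = -(((r * x - δ - ρ) * A + μ ^ 2 / (2 * σ ^ 2 * m))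
          * Real.exp ((-(m * x) - D) * A + G)) := by
    have hs : HasDerivAt (fun s => T - s) (-1) t := by
      simpa using (hasDerivAt_id t).const_sub T
    have hAs := (hs.const_mul r).exp
    have hBs := (hs.const_mul r).fun_neg.exp
    have h := (((((hBs.const_sub 1).const_mul (-((δ + ρ) * m / r))).const_sub (-(m * x))).fun_mul
      hAs).fun_add (hs.const_mul (-(μ ^ 2 / (2 * σ ^ 2))))).exp.const_mul (-(1 / m))
    rw [h.deriv, ← hA, ← hB, ← hD, ← hG]
    set E := Real.exp ((-(m * x) - D) * A + G)
    rw [hD]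
    field_simp
    ring
  rw [hVx, hVxx, hVt]
  set E := Real.exp ((-(m * x) - D) * A + G)
  have hEpos : 0 < E := Real.exp_pos _
  have hmax := isGreatest_image_Ici_of_vertex
    (a := -((1 / 2) * σ ^ 2 * (m * A ^ 2) * E)) (b := μ * (A * E))
    (c := (r * x - δ - ρ) * (A * E)) (v := μ / (σ ^ 2 * m) * B)
    (neg_nonpos.2 (by positivity)) (by positivity) (by
      field_simp
      linear_combination -hAB)
  have hgreatest : IsGreatest
      ((fun f => (1 / 2) * σ ^ 2 * f ^ 2 * (-(m * A ^ 2) * E)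
        + (r * x + μ * f - δ - ρ) * (A * E)) '' Set.Ici 0)
      ((1 / 2) * σ ^ 2 * (μ / (σ ^ 2 * m) * B) ^ 2 * (-(m * A ^ 2) * E)
        + (r * x + μ * (μ / (σ ^ 2 * m) * B) - δ - ρ) * (A * E)) := by
    convert hmax using 1
    · congr 1
      funext f
      ring
    · ring
  refine ⟨hgreatest, ?_⟩
  rw [hgreatest.csSup_eq]
  have hBA : B = A⁻¹ := eq_inv_of_mul_eq_one_right hAB
  rw [hBA]
  field_simp
  ring
end

section
/- Assume μ/σ² > β·m and let t₁ = inf{t ∈ [0,T] : f¹(t) ≥ β}. If there exists t ∈ [t₁, T] with h(t) ≥ 0, then ρ ≤ μ²/(2σ²m) + (1/2)β²σ²m - βμ. -/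
/-- A rate `ρ ≥ 0` whose growth `ρ x` is dominated by `c / 2 * (a - b x) ^ 2` at some `x ≥ 1`
with `b x ≤ a` is dominated by the value of that square at `x = 1`. -/
theorem le_half_mul_sq_sub_of_one_le {a b c ρ x : ℝ} (hb : 0 ≤ b) (hc : 0 ≤ c) (hρ : 0 ≤ ρ)
    (hx : 1 ≤ x) (hbx : b * x ≤ a) (h : ρ * x ≤ c / 2 * (a - b * x) ^ 2) :
    ρ ≤ c / 2 * (a - b) ^ 2 := by
  have hle : a - b * x ≤ a - b := by nlinarith
  have hnonneg : 0 ≤ a - b * x := sub_nonneg.2 hbx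
  calc ρ ≤ ρ * x := le_mul_of_one_le_right hρ hx
    _ ≤ c / 2 * (a - b * x) ^ 2 := h
    _ ≤ c / 2 * (a - b) ^ 2 := by gcongr

/-- A continuous monotone function that reaches the level `β` on `[a, b]` stays above it from the
first hitting time on. -/
theorem Monotone.le_of_sInf_hitting_le {f : ℝ → ℝ} (hf : Monotone f) (hcont : Continuous f)
    {a b β t : ℝ} (hab : a ≤ b) (hb : β ≤ f b)
    (ht : sInf {s ∈ Set.Icc a b | β ≤ f s} ≤ t) : β ≤ f t := by
  have hclosed : IsClosed {s ∈ Set.Icc a b | β ≤ f s} :=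
    isClosed_Icc.inter (isClosed_le continuous_const hcont)
  have hmem := hclosed.csInf_mem ⟨b, Set.right_mem_Icc.2 hab, hb⟩ ⟨a, fun s hs => hs.1.1⟩
  exact hmem.2.trans (hf ht)


/-- If `h(t) ≥ 0` for some `t ∈ [t₁,T]`, then the opportunity cost satisfies
`ρ ≤ μ²/(2σ²m) + (1/2)β²σ²m - βμ`. -/
theorem stmt_5
    (r μ σ m β T ρ : ℝ)
    (hr : 0 < r) (hμ : 0 < μ) (hσ : 0 < σ) (hm : 0 < m) (hβ : 0 < β) (hT : 0 < T)
    (hρ : 0 ≤ ρ)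
    (f1 h : ℝ → ℝ)
    (hf1 : ∀ t, f1 t = (μ / (σ ^ 2 * m)) * Real.exp (-(r * (T - t))))
    (hh : ∀ t, h t = μ ^ 2 / (2 * σ ^ 2 * m)
      + (1 / 2) * β ^ 2 * σ ^ 2 * m * Real.exp (2 * r * (T - t))
      - (β * μ + ρ) * Real.exp (r * (T - t)))
    (hcond : β * m < μ / σ ^ 2)
    (t₁ : ℝ) (ht₁ : t₁ = sInf {t ∈ Set.Icc (0 : ℝ) T | β ≤ f1 t})
    (hex : ∃ t ∈ Set.Icc t₁ T, 0 ≤ h t) :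
    ρ ≤ μ ^ 2 / (2 * σ ^ 2 * m) + (1 / 2) * β ^ 2 * σ ^ 2 * m - β * μ := by
  obtain ⟨t, ⟨ht₁t, htT⟩, ht⟩ := hex
  have hc : 0 < σ ^ 2 * m := by positivity
  have hβa : β ≤ μ / (σ ^ 2 * m) := by
    rw [← div_div, le_div_iff₀ hm]
    exact hcond.le
  have hf1_eq : f1 = fun t => (μ / (σ ^ 2 * m)) * Real.exp (-(r * (T - t))) := funext hf1
  have hcont : Continuous f1 := by
    rw [hf1_eq]
    fun_prop
  have hmono : Monotone f1 := by
    intro s t hst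
    rw [hf1, hf1]
    gcongr
  have hβt : β ≤ f1 t :=
    hmono.le_of_sInf_hitting_le hcont hT.le (by simpa [hf1] using hβa) (ht₁ ▸ ht₁t)
  have hx : 1 ≤ Real.exp (r * (T - t)) :=
    Real.one_le_exp (mul_nonneg hr.le (sub_nonneg.2 htT))
  have hβx : β * Real.exp (r * (T - t)) ≤ μ / (σ ^ 2 * m) := by
    rwa [hf1, Real.exp_neg, ← div_eq_mul_inv, le_div_iff₀ (Real.exp_pos _)] at hβt
  have hsq (x : ℝ) : σ ^ 2 * m / 2 * (μ / (σ ^ 2 * m) - β * x) ^ 2 =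
      μ ^ 2 / (2 * σ ^ 2 * m) + (1 / 2) * β ^ 2 * σ ^ 2 * m * x ^ 2 - β * μ * x := by
    field_simp
    ring
  have hexp : Real.exp (2 * r * (T - t)) = Real.exp (r * (T - t)) ^ 2 := by
    rw [← Real.exp_nat_mul]
    push_cast
    ring_nf
  rw [hh, hexp] at ht
  have hρx : ρ * Real.exp (r * (T - t)) ≤
      σ ^ 2 * m / 2 * (μ / (σ ^ 2 * m) - β * Real.exp (r * (T - t))) ^ 2 := by
    rw [hsq]
    linarith
  have hmain := le_half_mul_sq_sub_of_one_le hβ.le hc.le hρ hx hβx hρx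
  have hsq_one := hsq 1
  rw [mul_one, one_pow, mul_one, mul_one] at hsq_one
  exact hmain.trans_eq hsq_one
end

section
/- For all (t,x) ∈ [0,T]×ℝ, the identity ∂_t V¹(t,x) + (1/2)β²σ²·∂_{xx}V¹(t,x) + (r x + βμ - δ)·∂_x V¹(t,x) = m·h(t)·V¹(t,x) holds. -/
/-- The identity
`∂ₜV¹ + (1/2)β²σ²·∂ₓₓV¹ + (rx + βμ - δ)·∂ₓV¹ = m·h(t)·V¹` on `[0,T]×ℝ`. -/
theorem stmt_7
    (r μ σ m β T δ ρ : ℝ)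
    (hr : 0 < r) (hμ : 0 < μ) (hσ : 0 < σ) (hm : 0 < m) (hβ : 0 < β) (hT : 0 < T)
    (hδ : 0 ≤ δ) (hρ : 0 ≤ ρ)
    (d g : ℝ → ℝ) (V1 : ℝ → ℝ → ℝ) (h : ℝ → ℝ)
    (hd : ∀ t, d t = -((δ + ρ) * m / r) * (1 - Real.exp (-(r * (T - t)))))
    (hg : ∀ t, g t = -(μ ^ 2 / (2 * σ ^ 2)) * (T - t))
    (hV1 : ∀ t x, V1 t x =
      -(1 / m) * Real.exp ((-(m * x) - d t) * Real.exp (r * (T - t)) + g t))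
    (hh : ∀ t, h t = μ ^ 2 / (2 * σ ^ 2 * m)
      + (1 / 2) * β ^ 2 * σ ^ 2 * m * Real.exp (2 * r * (T - t))
      - (β * μ + ρ) * Real.exp (r * (T - t))) :
    ∀ t ∈ Set.Icc (0 : ℝ) T, ∀ x : ℝ,
      deriv (fun s => V1 s x) t
        + (1 / 2) * β ^ 2 * σ ^ 2 * deriv (deriv (fun y => V1 t y)) x
        + (r * x + β * μ - δ) * deriv (fun y => V1 t y) x
      = m * h t * V1 t x := by
  intro t _ x
  have hV (s y : ℝ) : V1 s y = -(1 / m) * Real.exp (-(m * y) * Real.exp (r * (T - s))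
      + (δ + ρ) * m / r * (Real.exp (r * (T - s)) - 1) - μ ^ 2 / (2 * σ ^ 2) * (T - s)) := by
    have hE : Real.exp (-(r * (T - s))) * Real.exp (r * (T - s)) = 1 := by
      rw [← Real.exp_add, neg_add_cancel, Real.exp_zero]
    rw [hV1, hd, hg]
    congr 2
    linear_combination -((δ + ρ) * m / r) * hE
  have hEt : HasDerivAt (fun s => Real.exp (r * (T - s))) (-r * Real.exp (r * (T - t))) t := by
    convert (((hasDerivAt_id' t).const_sub T).const_mul r).exp using 1
    ring
  have hVt : HasDerivAt (fun s => V1 s x)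
      ((m * r * x * Real.exp (r * (T - t)) - (δ + ρ) * m * Real.exp (r * (T - t))
        + μ ^ 2 / (2 * σ ^ 2)) * V1 t x) t := by
    simp only [hV]
    refine HasDerivAt.congr_deriv ((((hEt.const_mul (-(m * x))).add
      ((hEt.sub_const 1).const_mul ((δ + ρ) * m / r))).sub
      (((hasDerivAt_id' t).const_sub T).const_mul (μ ^ 2 / (2 * σ ^ 2)))).exp.const_mul
      (-(1 / m))) ?_
    simp only [Pi.add_apply, Pi.sub_apply]
    field_simp
    ring
  have hVx (y : ℝ) : HasDerivAt (fun y => V1 t y)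
      (-(m * Real.exp (r * (T - t))) * V1 t y) y := by
    simp only [hV]
    refine HasDerivAt.congr_deriv (((((((hasDerivAt_id' y).const_mul m).neg).mul_const
      (Real.exp (r * (T - t)))).add_const
      ((δ + ρ) * m / r * (Real.exp (r * (T - t)) - 1))).sub_const
      (μ ^ 2 / (2 * σ ^ 2) * (T - t))).exp.const_mul (-(1 / m))) ?_
    simp only [Pi.neg_apply]
    ring
  have hVx' : deriv (fun y => V1 t y) = fun y => -(m * Real.exp (r * (T - t))) * V1 t y :=
    funext fun y => (hVx y).deriv
  have hE2 : Real.exp (2 * r * (T - t)) = Real.exp (r * (T - t)) ^ 2 := by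
    rw [← Real.exp_nat_mul]
    congr 1
    push_cast
    ring
  rw [hVx', ((hVx x).const_mul _).deriv, hVt.deriv, hh, hE2]
  field_simp
  ring
end

section
/- Assume μ/σ² > β·m and ρ ≤ μ²/(2σ²m) + (1/2)β²σ²m - βμ. Then the function P satisfies: (i) P(t,x) ≥ 0 for all (t,x) ∈ [t₁,T]×ℝ; (ii) for all (t,x) ∈ [t₁,t₂)×ℝ, ∂_t P(t,x) + (1/2)β²σ²·∂_{xx}P(t,x) + (r x + βμ - δ)·∂_x P(t,x) = -m·h(t)·V¹(t,x); (iii) for all (t,x) ∈ [t₂,T]×ℝ, ∂_t P(t,x) + (1/2)β²σ²·∂_{xx}P(t,x) + (r x + βμ - δ)·∂_x P(t,x) ≤ -m·h(t)·V¹(t,x); and (iv) P(T,x) = 0 for all x ∈ ℝ. -/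
/-- A function on `ℝ` that vanishes on `[a, ∞)` has zero `deriv` at every point of `[a, ∞)`,
including the end point, where it need not be differentiable. -/
theorem deriv_eq_zero_of_eqOn_Ici {f : ℝ → ℝ} {a t : ℝ} (hf : ∀ s, a ≤ s → f s = 0)
    (ht : a ≤ t) : deriv f t = 0 := by
  by_cases hdiff : DifferentiableAt ℝ f t
  · have hzero : HasDerivWithinAt f 0 (Set.Ici t) t :=
      (hasDerivWithinAt_const t (Set.Ici t) (0 : ℝ)).congr
        (fun s hs => hf s (ht.trans hs)) (hf t ht)
    exact (uniqueDiffWithinAt_Ici t).eq_deriv _ hdiff.hasDerivAt.hasDerivWithinAt hzero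
  · exact deriv_zero_of_not_differentiableAt hdiff

/-- The infimum of a nonempty closed superlevel set within a compact interval belongs to it. -/
theorem sInf_superlevel_mem {f : ℝ → ℝ} (hf : Continuous f) {a b c : ℝ} (hab : a ≤ b)
    (hb : c ≤ f b) :
    sInf {t ∈ Set.Icc a b | c ≤ f t} ∈ {t ∈ Set.Icc a b | c ≤ f t} := by
  have hclosed : IsClosed {t ∈ Set.Icc a b | c ≤ f t} :=
    isClosed_Icc.inter (isClosed_le continuous_const hf)
  exact hclosed.csInf_mem ⟨b, ⟨hab, le_rfl⟩, hb⟩ ⟨a, fun t ht => ht.1.1⟩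

/-- A convex quadratic `a + b y² - c y` is antitone up to its vertex. -/
theorem quadratic_le_of_le_vertex {a b c y z : ℝ} (hb : 0 ≤ b) (hyz : y ≤ z)
    (hz : 2 * b * z ≤ c) : a + b * z ^ 2 - c * z ≤ a + b * y ^ 2 - c * y := by
  nlinarith [mul_nonneg (sub_nonneg.2 hyz) (sub_nonneg.2 hz),
    mul_nonneg hb (sq_nonneg (z - y))]

theorem hasDerivAt_exp_mul_sub (r T t : ℝ) :
    HasDerivAt (fun s => Real.exp (r * (T - s))) (-(r * Real.exp (r * (T - t)))) t := by
  refine (((hasDerivAt_id' t).const_sub T).const_mul r).exp.congr_deriv ?_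
  ring

/-- The time derivative of the exponent of `V¹`. -/
theorem hasDerivAt_valueExponent {r : ℝ} (hr : r ≠ 0) (κ m ν T t x : ℝ) :
    HasDerivAt (fun s => (-(m * x) - -(κ * m / r) * (1 - Real.exp (-(r * (T - s)))))
        * Real.exp (r * (T - s)) + -ν * (T - s))
      ((r * x - κ) * m * Real.exp (r * (T - t)) + ν) t := by
  have hfun : (fun s => (-(m * x) - -(κ * m / r) * (1 - Real.exp (-(r * (T - s)))))
        * Real.exp (r * (T - s)) + -ν * (T - s))
      = fun s => (κ * m / r - m * x) * Real.exp (r * (T - s)) - κ * m / r + -ν * (T - s) := by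
    funext s
    have hexp : Real.exp (-(r * (T - s))) * Real.exp (r * (T - s)) = 1 := by
      rw [← Real.exp_add, neg_add_cancel, Real.exp_zero]
    linear_combination (-(κ * m / r)) * hexp
  rw [hfun]
  refine ((((hasDerivAt_exp_mul_sub r T t).const_mul (κ * m / r - m * x)).sub_const
    (κ * m / r)).add (((hasDerivAt_id' t).const_sub T).const_mul (-ν))).congr_deriv ?_
  field_simp
  ring

/-- The function `P` (value gap of the auxiliary problem) satisfies the
variational inequality \eqref{VI:P}: `P ≥ 0` on `[t₁,T]×ℝ`, the PDE holds with equality on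
`[t₁,t₂)×ℝ`, the inequality holds on `[t₂,T]×ℝ`, and `P(T,·) = 0`. -/
theorem stmt_9
    (r μ σ m β T δ ρ : ℝ)
    (hr : 0 < r) (hμ : 0 < μ) (hσ : 0 < σ) (hm : 0 < m) (hβ : 0 < β) (hT : 0 < T)
    (hδ : 0 ≤ δ) (hρ : 0 ≤ ρ)
    (hcond1 : β * m < μ / σ ^ 2)
    (hcond2 : ρ ≤ μ ^ 2 / (2 * σ ^ 2 * m) + (1 / 2) * β ^ 2 * σ ^ 2 * m - β * μ)
    (d g : ℝ → ℝ) (V1 : ℝ → ℝ → ℝ) (f1 h : ℝ → ℝ)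
    (hd : ∀ t, d t = -((δ + ρ) * m / r) * (1 - Real.exp (-(r * (T - t)))))
    (hg : ∀ t, g t = -(μ ^ 2 / (2 * σ ^ 2)) * (T - t))
    (hV1 : ∀ t x, V1 t x =
      -(1 / m) * Real.exp ((-(m * x) - d t) * Real.exp (r * (T - t)) + g t))
    (hf1 : ∀ t, f1 t = (μ / (σ ^ 2 * m)) * Real.exp (-(r * (T - t))))
    (hh : ∀ t, h t = μ ^ 2 / (2 * σ ^ 2 * m)
      + (1 / 2) * β ^ 2 * σ ^ 2 * m * Real.exp (2 * r * (T - t))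
      - (β * μ + ρ) * Real.exp (r * (T - t)))
    (t₁ : ℝ) (ht₁ : t₁ = sInf {t ∈ Set.Icc (0 : ℝ) T | β ≤ f1 t})
    (t₂ : ℝ) (ht₂ : t₂ = sInf {t ∈ Set.Icc t₁ T | 0 ≤ h t})
    (P : ℝ → ℝ → ℝ)
    (hP : ∀ t x, P t x =
      if t < t₂ then -(1 - Real.exp (∫ s in t..t₂, m * h s)) * V1 t x else 0) :
    (∀ t ∈ Set.Icc t₁ T, ∀ x : ℝ, 0 ≤ P t x) ∧
    (∀ t ∈ Set.Ico t₁ t₂, ∀ x : ℝ,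
      deriv (fun s => P s x) t
        + (1 / 2) * β ^ 2 * σ ^ 2 * deriv (deriv (fun y => P t y)) x
        + (r * x + β * μ - δ) * deriv (fun y => P t y) x
      = -(m * h t * V1 t x)) ∧
    (∀ t ∈ Set.Icc t₂ T, ∀ x : ℝ,
      deriv (fun s => P s x) t
        + (1 / 2) * β ^ 2 * σ ^ 2 * deriv (deriv (fun y => P t y)) x
        + (r * x + β * μ - δ) * deriv (fun y => P t y) x
      ≤ -(m * h t * V1 t x)) ∧
    (∀ x : ℝ, P T x = 0) := by
  have hq2 : ∀ t, Real.exp (2 * r * (T - t)) = Real.exp (r * (T - t)) ^ 2 := fun t => by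
    rw [← Real.exp_nat_mul]
    congr 1
    push_cast
    ring
  have hf1_cont : Continuous f1 := by
    rw [funext hf1]
    fun_prop
  have hh_cont : Continuous h := by
    rw [funext hh]
    fun_prop
  have hf1T : β ≤ f1 T := by
    have hdiv : μ / (σ ^ 2 * m) = μ / σ ^ 2 / m := by rw [div_div]
    simp only [hf1, sub_self, mul_zero, neg_zero, Real.exp_zero, mul_one, hdiv]
    rw [le_div_iff₀ hm]
    exact hcond1.le
  have hhT : 0 ≤ h T := by
    simp only [hh, sub_self, mul_zero, Real.exp_zero, mul_one]
    linarith
  have ht₁mem := sInf_superlevel_mem hf1_cont hT.le hf1T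
  rw [← ht₁] at ht₁mem
  obtain ⟨⟨-, ht₁T⟩, hf1t₁⟩ := ht₁mem
  have ht₂mem := sInf_superlevel_mem hh_cont ht₁T hhT
  rw [← ht₂] at ht₂mem
  obtain ⟨⟨ht₁₂, ht₂T⟩, hht₂⟩ := ht₂mem
  have hvertex : 2 * ((1 / 2) * β ^ 2 * σ ^ 2 * m) * Real.exp (r * (T - t₁)) ≤ β * μ + ρ := by
    rw [hf1, Real.exp_neg, ← div_eq_mul_inv, le_div_iff₀ (Real.exp_pos _),
      le_div_iff₀ (by positivity)] at hf1t₁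
    nlinarith [mul_le_mul_of_nonneg_left hf1t₁ hβ.le]
  have hh_nonneg : ∀ t, t₂ ≤ t → 0 ≤ h t := fun t ht => by
    refine hht₂.trans ?_
    rw [hh, hh, hq2, hq2]
    refine quadratic_le_of_le_vertex (by positivity) (by gcongr) ?_
    refine le_trans ?_ hvertex
    gcongr
  have hh_neg : ∀ t ∈ Set.Ico t₁ t₂, h t < 0 := fun t ht => by
    by_contra! hnonneg
    have hle : t₂ ≤ t := ht₂ ▸
      csInf_le ⟨t₁, fun s hs => hs.1.1⟩ ⟨⟨ht.1, ht.2.le.trans ht₂T⟩, hnonneg⟩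
    exact absurd ht.2 hle.not_gt
  have hV1_neg : ∀ t x, V1 t x < 0 := fun t x => by
    rw [hV1, neg_mul, neg_lt_zero]
    positivity
  have hP_zero : ∀ t, t₂ ≤ t → ∀ x, P t x = 0 := fun t ht x => by
    rw [hP, if_neg ht.not_gt]
  refine ⟨fun t ht x => ?_, fun t ht x => ?_, fun t ht x => ?_, hP_zero T ht₂T⟩
  · rcases lt_or_ge t t₂ with htt | htt
    · rw [hP, if_pos htt]
      have hint : ∫ s in t..t₂, m * h s ≤ 0 := by
        have hcont : Continuous fun u => m * h u := by fun_prop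
        have hmono := intervalIntegral.integral_mono_on_of_le_Ioo (μ := MeasureTheory.volume)
          (g := fun _ => (0 : ℝ)) htt.le
          (hcont.intervalIntegrable t t₂) (continuous_const.intervalIntegrable t t₂) fun s hs =>
            mul_nonpos_of_nonneg_of_nonpos hm.le (hh_neg s ⟨ht.1.trans hs.1.le, hs.2⟩).le
        simpa using hmono
      have hexp := Real.exp_le_one_iff.2 hint
      nlinarith [hV1_neg t x]
    · exact (hP_zero t htt x).ge
  · have hV1_t : HasDerivAt (fun s => V1 s x)
        (V1 t x * ((r * x - (δ + ρ)) * m * Real.exp (r * (T - t)) + μ ^ 2 / (2 * σ ^ 2))) t := by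
      simp only [hV1, hd, hg]
      refine ((hasDerivAt_valueExponent hr.ne' (δ + ρ) m (μ ^ 2 / (2 * σ ^ 2)) T t
        x).exp.const_mul (-(1 / m))).congr_deriv ?_
      ring
    have hV1_x : ∀ y, HasDerivAt (V1 t) (-(m * Real.exp (r * (T - t))) * V1 t y) y := fun y => by
      rw [funext (hV1 t)]
      refine ((((((hasDerivAt_id' y).const_mul m).fun_neg.sub_const (d t)).mul_const
        (Real.exp (r * (T - t)))).add_const (g t)).exp.const_mul (-(1 / m))).congr_deriv ?_
      ring
    have hI : HasDerivAt (fun s => ∫ u in s..t₂, m * h u) (-(m * h t)) t := by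
      have hcont : Continuous fun u => m * h u := by fun_prop
      exact intervalIntegral.integral_hasDerivAt_left (hcont.intervalIntegrable _ _)
        (hcont.stronglyMeasurableAtFilter _ _) hcont.continuousAt
    have hPx : (fun y => P t y) = fun y => -(1 - Real.exp (∫ s in t..t₂, m * h s)) * V1 t y :=
      funext fun y => by rw [hP, if_pos ht.2]
    have hP_x : deriv (fun y => P t y) = fun y =>
        -(1 - Real.exp (∫ s in t..t₂, m * h s)) * (-(m * Real.exp (r * (T - t))) * V1 t y) := by
      rw [hPx]
      exact funext fun y => ((hV1_x y).const_mul _).deriv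
    have hP_xx := (((hV1_x x).const_mul (-(m * Real.exp (r * (T - t))))).const_mul
      (-(1 - Real.exp (∫ s in t..t₂, m * h s)))).deriv
    have hP_eq : (fun s => P s x) =ᶠ[nhds t]
        fun s => -(1 - Real.exp (∫ u in s..t₂, m * h u)) * V1 s x := by
      filter_upwards [eventually_lt_nhds ht.2] with s hs
      rw [hP, if_pos hs]
    have hP_t := ((hI.exp.const_sub 1).fun_neg.fun_mul hV1_t).deriv
    rw [hP_eq.deriv_eq, hP_t, hP_x, hP_xx, hh, hq2]
    field_simp
    ring
  · have hP_t : deriv (fun s => P s x) t = 0 :=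
      deriv_eq_zero_of_eqOn_Ici (fun s hs => hP_zero s hs x) ht.1
    have hPx : (fun y => P t y) = fun _ => 0 := funext (hP_zero t ht.1)
    simp only [hP_t, hPx, deriv_const', mul_zero, add_zero]
    nlinarith [mul_nonneg (mul_nonneg hm.le (hh_nonneg t ht.1)) (neg_nonneg.2 (hV1_neg t x).le)]
end

section
/- Assume μ/σ² > β·m and ρ ≤ μ²/(2σ²m) + (1/2)β²σ²m - βμ. Then for all (t,x) ∈ [0,t₁)×ℝ: f¹(t) ∈ (0,β), ∂_x V(t,x) > 0, ∂_{xx}V(t,x) < 0, the supremum over f ∈ [0,β] of (1/2)σ²f²·∂_{xx}V(t,x) + (r x + μ f - δ)·∂_x V(t,x) is attained at f = f¹(t), and the constrained Hamilton–Jacobi–Bellman equation ∂_t V(t,x) + sup_{f ∈ [0,β]} [ (1/2)σ²f²·∂_{xx}V(t,x) + (r x + μ f - δ)·∂_x V(t,x) ] = 0 holds; moreover d₀(t₁) = -((δ+ρ)m/r)·(1 - e^{-r(T-t₁)}). -/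
/-- The concave quadratic Hamiltonian in `f` equals its value at the stationary point minus a square. -/
theorem quadratic_hamiltonian_eq (a p q μ f₀ f c : ℝ) (hf₀ : a * f₀ * q = -(μ * p)) :
    (1 / 2) * a * f ^ 2 * q + (c + μ * f) * p
      = (1 / 2) * a * f₀ ^ 2 * q + (c + μ * f₀) * p + (1 / 2) * a * q * (f - f₀) ^ 2 := by
  linear_combination (f - f₀) * hf₀

/-- On `[0,t₁)×ℝ` the value function `V` (with coefficients `d₀`, `g₀`)
satisfies `f¹(t) ∈ (0,β)`, `∂ₓV > 0`, `∂ₓₓV < 0`, the constrained Hamiltonian over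
`f ∈ [0,β]` is maximized at `f¹(t)`, the constrained HJB equation holds, and
`d₀(t₁) = -((δ+ρ)m/r)(1 - e^{-r(T-t₁)})`. -/
theorem stmt_13
    (r μ σ m β T δ ρ : ℝ)
    (hr : 0 < r) (hμ : 0 < μ) (hσ : 0 < σ) (hm : 0 < m) (hβ : 0 < β) (hT : 0 < T)
    (hδ : 0 ≤ δ) (hρ : 0 ≤ ρ)
    (hcond1 : β * m < μ / σ ^ 2)
    (hcond2 : ρ ≤ μ ^ 2 / (2 * σ ^ 2 * m) + (1 / 2) * β ^ 2 * σ ^ 2 * m - β * μ)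
    (f1 h : ℝ → ℝ)
    (hf1 : ∀ t, f1 t = (μ / (σ ^ 2 * m)) * Real.exp (-(r * (T - t))))
    (hh : ∀ t, h t = μ ^ 2 / (2 * σ ^ 2 * m)
      + (1 / 2) * β ^ 2 * σ ^ 2 * m * Real.exp (2 * r * (T - t))
      - (β * μ + ρ) * Real.exp (r * (T - t)))
    (t₁ : ℝ) (ht₁ : t₁ = sInf {t ∈ Set.Icc (0 : ℝ) T | β ≤ f1 t})
    (t₂ : ℝ) (ht₂ : t₂ = sInf {t ∈ Set.Icc t₁ T | 0 ≤ h t})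
    (d₀ g₀ : ℝ → ℝ) (V : ℝ → ℝ → ℝ)
    (hd₀ : ∀ t, d₀ t = ((δ + ρ) * m / r - (ρ * m / r) * Real.exp (r * (T - t₁)))
      * Real.exp (-(r * (T - t))) - δ * m / r)
    (hg₀ : ∀ t, g₀ t = -(μ ^ 2 / (2 * σ ^ 2)) * (T - t) + ∫ s in t₁..t₂, m * h s)
    (hV : ∀ t x, V t x =
      -(1 / m) * Real.exp ((-(m * x) - d₀ t) * Real.exp (r * (T - t)) + g₀ t)) :
    (∀ t ∈ Set.Ico (0 : ℝ) t₁, ∀ x : ℝ,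
      f1 t ∈ Set.Ioo (0 : ℝ) β ∧
      0 < deriv (fun y => V t y) x ∧
      deriv (deriv (fun y => V t y)) x < 0 ∧
      IsGreatest
        ((fun f => (1 / 2) * σ ^ 2 * f ^ 2 * deriv (deriv (fun y => V t y)) x
            + (r * x + μ * f - δ) * deriv (fun y => V t y) x) '' Set.Icc 0 β)
        ((1 / 2) * σ ^ 2 * (f1 t) ^ 2 * deriv (deriv (fun y => V t y)) x
            + (r * x + μ * (f1 t) - δ) * deriv (fun y => V t y) x) ∧
      deriv (fun s => V s x) t
        + sSup ((fun f => (1 / 2) * σ ^ 2 * f ^ 2 * deriv (deriv (fun y => V t y)) x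
            + (r * x + μ * f - δ) * deriv (fun y => V t y) x) '' Set.Icc 0 β) = 0) ∧
    d₀ t₁ = -((δ + ρ) * m / r) * (1 - Real.exp (-(r * (T - t₁)))) := by
  have hf1_pos : ∀ t, 0 < f1 t := fun t => by rw [hf1]; positivity
  have hT_mem : T ∈ {t ∈ Set.Icc (0 : ℝ) T | β ≤ f1 t} := by
    refine ⟨⟨hT.le, le_rfl⟩, ?_⟩
    rw [hf1, sub_self, mul_zero, neg_zero, Real.exp_zero, mul_one, ← div_div, le_div_iff₀ hm]
    exact hcond1.le
  have hbdd : BddBelow {t ∈ Set.Icc (0 : ℝ) T | β ≤ f1 t} := ⟨0, fun t ht => ht.1.1⟩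
  have ht₁T : t₁ ≤ T := ht₁ ▸ csInf_le hbdd hT_mem
  have hexp_neg : ∀ t, Real.exp (-(r * (T - t))) = (Real.exp (r * (T - t)))⁻¹ :=
    fun t => Real.exp_neg _
  refine ⟨fun t ht x => ?_, ?_⟩
  · have hf1_lt : f1 t < β := by
      by_contra! hle
      have : t₁ ≤ t := ht₁ ▸ csInf_le hbdd ⟨⟨ht.1, ht.2.le.trans ht₁T⟩, hle⟩
      exact absurd ht.2 this.not_gt
    set E := Real.exp (r * (T - t)) with hE
    have hEpos : 0 < E := Real.exp_pos _
    have hexponent : ∀ y, HasDerivAt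
        (fun z => (-(m * z) - d₀ t) * E + g₀ t) (-m * E) y := fun y => by
      simpa using (((((hasDerivAt_id y).const_mul m).neg).sub_const (d₀ t)).mul_const E).add_const
        (g₀ t)
    have hVx : deriv (fun y => V t y)
        = fun y => E * Real.exp ((-(m * y) - d₀ t) * E + g₀ t) := by
      funext y
      rw [funext (hV t)]
      refine (((hexponent y).exp).const_mul (-(1 / m))).deriv.trans ?_
      field_simp
    have hVxx : deriv (deriv (fun y => V t y)) x
        = -(m * E ^ 2) * Real.exp ((-(m * x) - d₀ t) * E + g₀ t) := by
      rw [hVx]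
      refine (((hexponent x).exp).const_mul E).deriv.trans ?_
      ring
    have hVt : deriv (fun s => V s x) t
        = -(1 / m) * (Real.exp ((-(m * x) - d₀ t) * E + g₀ t)
          * ((r * m * x - δ * m) * E + μ ^ 2 / (2 * σ ^ 2))) := by
      have hlin : HasDerivAt (fun s => T - s) (-1) t := by
        simpa using (hasDerivAt_id t).const_sub T
      have hexp : HasDerivAt (fun s => Real.exp (r * (T - s))) (E * (r * -1)) t :=
        (hlin.const_mul r).exp
      have hfun : (fun s => (-(m * x) - d₀ s) * Real.exp (r * (T - s)) + g₀ s)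
          = fun s => (-(m * x) + δ * m / r) * Real.exp (r * (T - s))
            - ((δ + ρ) * m / r - (ρ * m / r) * Real.exp (r * (T - t₁)))
            + (-(μ ^ 2 / (2 * σ ^ 2)) * (T - s) + ∫ u in t₁..t₂, m * h u) := by
        funext s
        rw [hd₀, hg₀, hexp_neg s]
        have := (Real.exp_pos (r * (T - s))).ne'
        field_simp
        ring
      have hφ : HasDerivAt (fun s => (-(m * x) - d₀ s) * Real.exp (r * (T - s)) + g₀ s)
          ((r * m * x - δ * m) * E + μ ^ 2 / (2 * σ ^ 2)) t := by
        rw [hfun]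
        refine (((hexp.const_mul _).sub_const _).add
          ((hlin.const_mul _).add_const _)).congr_deriv ?_
        field_simp
        ring
      rw [funext fun s => hV s x]
      exact (hφ.exp.const_mul _).deriv
    rw [hVxx, hVt, hVx]
    set W := Real.exp ((-(m * x) - d₀ t) * E + g₀ t) with hW
    have hWpos : 0 < W := Real.exp_pos _
    have hf1E : f1 t = μ / (σ ^ 2 * m) * E⁻¹ := by rw [hf1, hexp_neg]
    have hstat : σ ^ 2 * f1 t * (-(m * E ^ 2) * W) = -(μ * (E * W)) := by
      rw [hf1E]
      field_simp
    have hmax : IsGreatest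
        ((fun f => (1 / 2) * σ ^ 2 * f ^ 2 * (-(m * E ^ 2) * W)
            + (r * x + μ * f - δ) * (E * W)) '' Set.Icc 0 β)
        ((1 / 2) * σ ^ 2 * (f1 t) ^ 2 * (-(m * E ^ 2) * W)
            + (r * x + μ * (f1 t) - δ) * (E * W)) := by
      refine ⟨⟨f1 t, ⟨(hf1_pos t).le, hf1_lt.le⟩, rfl⟩, ?_⟩
      rintro _ ⟨f, -, rfl⟩
      have hquad := quadratic_hamiltonian_eq (σ ^ 2) (E * W) (-(m * E ^ 2) * W) μ (f1 t) f
        (r * x - δ) hstat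
      have hsq : 0 ≤ σ ^ 2 * (m * E ^ 2 * W) * (f - f1 t) ^ 2 := by positivity
      beta_reduce
      linarith
    refine ⟨⟨hf1_pos t, hf1_lt⟩, by positivity, ?_, hmax, ?_⟩
    · have : 0 < m * E ^ 2 * W := by positivity
      linarith
    · rw [hmax.csSup_eq, hf1E]
      field_simp
      ring
  · rw [hd₀, hexp_neg]
    have := (Real.exp_pos (r * (T - t₁))).ne'
    field_simp
    ring
end

section
/- If μ/σ² ≥ β·m·e^{rT}, ρ > (μ²/(2σ²m))·e^{-rT} + (1/2)β²σ²m·e^{rT} - βμ, and ρ ≤ μ²/(2σ²m) + (1/2)β²σ²m - βμ, then t₁ = inf{t ∈ [0,T] : f¹(t) ≥ β} = 0 and t₂ = inf{t ∈ [t₁,T] : h(t) ≥ 0} = T - (1/r)·ln( ((βμ+ρ) - √((βμ+ρ)² - β²μ²)) / (β²σ²m) ), with 0 < t₂ ≤ T. -/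
/-- A quadratic with positive leading coefficient that is negative at `X` and nonnegative at some
`y < X` has its smaller root in `[y, X)` and its larger root above `X`. -/
theorem roots_bracket_of_neg_of_nonneg {a x₁ x₂ y X : ℝ} (ha : 0 < a) (hx : x₁ ≤ x₂) (hyX : y < X)
    (hX : a * ((X - x₁) * (X - x₂)) < 0) (hy : 0 ≤ a * ((y - x₁) * (y - x₂))) :
    y ≤ x₁ ∧ x₁ < X ∧ X < x₂ := by
  have hX' : (X - x₁) * (X - x₂) < 0 :=
    (pos_iff_neg_of_mul_neg hX).1 ha
  have hy' : 0 ≤ (y - x₁) * (y - x₂) := nonneg_of_mul_nonneg_right hy ha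
  have h₁ : x₁ < X := by
    by_contra! hc
    nlinarith
  have h₂ : X < x₂ := by
    by_contra! hc
    nlinarith
  refine ⟨?_, h₁, h₂⟩
  by_contra! hc
  nlinarith

/-- The first time at which a quadratic in `exp (r * (T - t))` becomes nonnegative. -/
theorem isLeast_nonneg_quadratic_exp {r T a x₁ x₂ : ℝ} (hr : 0 < r) (hT : 0 < T) (ha : 0 < a)
    (hx : x₁ ≤ x₂)
    (hX : a * ((Real.exp (r * T) - x₁) * (Real.exp (r * T) - x₂)) < 0)
    (hone : 0 ≤ a * ((1 - x₁) * (1 - x₂))) :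
    IsLeast {t ∈ Set.Icc 0 T |
        0 ≤ a * ((Real.exp (r * (T - t)) - x₁) * (Real.exp (r * (T - t)) - x₂))}
      (T - 1 / r * Real.log x₁) ∧
    0 < T - 1 / r * Real.log x₁ ∧ T - 1 / r * Real.log x₁ ≤ T := by
  obtain ⟨h₁, h₁X, hX₂⟩ := roots_bracket_of_neg_of_nonneg ha hx
    (Real.one_lt_exp_iff.2 (mul_pos hr hT)) hX hone
  have hx₁ : 0 < x₁ := one_pos.trans_le h₁
  have hlog : 0 ≤ Real.log x₁ := Real.log_nonneg h₁
  have hlog' : Real.log x₁ < r * T := (Real.log_lt_iff_lt_exp hx₁).2 h₁X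
  have hpos : 0 < T - 1 / r * Real.log x₁ := by
    rw [one_div_mul_eq_div, sub_pos, div_lt_iff₀ hr]
    linarith
  have hle : T - 1 / r * Real.log x₁ ≤ T := sub_le_self _ (by positivity)
  refine ⟨⟨⟨⟨hpos.le, hle⟩, ?_⟩, ?_⟩, hpos, hle⟩
  · have he : r * (T - (T - 1 / r * Real.log x₁)) = Real.log x₁ := by
      field_simp
      ring
    rw [he, Real.exp_log hx₁]
    simp
  · rintro t ⟨⟨ht0, -⟩, ht⟩
    have hle_exp : Real.exp (r * (T - t)) ≤ Real.exp (r * T) :=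
      Real.exp_le_exp.2 (by nlinarith)
    have hexp : Real.exp (r * (T - t)) ≤ x₁ := by
      by_contra! hc
      exact ht.not_gt (mul_neg_of_pos_of_neg ha
        (mul_neg_of_pos_of_neg (sub_pos.2 hc) (by linarith)))
    have hlog_ge := (Real.le_log_iff_exp_le hx₁).2 hexp
    rw [one_div_mul_eq_div, sub_le_comm, le_div_iff₀ hr]
    linarith


/-- Case 2: If `μ/σ² ≥ βm·e^{rT}`,
`ρ > (μ²/(2σ²m))e^{-rT} + (1/2)β²σ²m·e^{rT} - βμ`, and
`ρ ≤ μ²/(2σ²m) + (1/2)β²σ²m - βμ`, then `t₁ = 0` and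
`t₂ = T - (1/r)·ln(((βμ+ρ) - √((βμ+ρ)² - β²μ²))/(β²σ²m))` with `0 < t₂ ≤ T`. -/
theorem stmt_15
    (r μ σ m β T ρ : ℝ)
    (hr : 0 < r) (hμ : 0 < μ) (hσ : 0 < σ) (hm : 0 < m) (hβ : 0 < β) (hT : 0 < T)
    (hρ : 0 ≤ ρ)
    (f1 h : ℝ → ℝ)
    (hf1 : ∀ t, f1 t = (μ / (σ ^ 2 * m)) * Real.exp (-(r * (T - t))))
    (hh : ∀ t, h t = μ ^ 2 / (2 * σ ^ 2 * m)
      + (1 / 2) * β ^ 2 * σ ^ 2 * m * Real.exp (2 * r * (T - t))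
      - (β * μ + ρ) * Real.exp (r * (T - t)))
    (hcond1 : β * m * Real.exp (r * T) ≤ μ / σ ^ 2)
    (hcond2 : (μ ^ 2 / (2 * σ ^ 2 * m)) * Real.exp (-(r * T))
      + (1 / 2) * β ^ 2 * σ ^ 2 * m * Real.exp (r * T) - β * μ < ρ)
    (hcond3 : ρ ≤ μ ^ 2 / (2 * σ ^ 2 * m) + (1 / 2) * β ^ 2 * σ ^ 2 * m - β * μ)
    (t₁ : ℝ) (ht₁ : t₁ = sInf {t ∈ Set.Icc (0 : ℝ) T | β ≤ f1 t})
    (t₂ : ℝ) (ht₂ : t₂ = sInf {t ∈ Set.Icc t₁ T | 0 ≤ h t}) :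
    t₁ = 0 ∧
    t₂ = T - (1 / r) * Real.log (((β * μ + ρ)
      - Real.sqrt ((β * μ + ρ) ^ 2 - β ^ 2 * μ ^ 2)) / (β ^ 2 * σ ^ 2 * m)) ∧
    0 < t₂ ∧ t₂ ≤ T := by
  have h0 : t₁ = 0 := by
    rw [ht₁]
    refine IsLeast.csInf_eq ⟨⟨⟨le_rfl, hT.le⟩, ?_⟩, fun t ht => ht.1.1⟩
    rw [hf1, sub_zero, Real.exp_neg, ← div_eq_mul_inv, le_div_iff₀ (Real.exp_pos _),
      le_div_iff₀ (by positivity)]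
    rw [le_div_iff₀ (by positivity)] at hcond1
    linarith
  subst h0
  refine ⟨rfl, ?_⟩
  set s := Real.sqrt ((β * μ + ρ) ^ 2 - β ^ 2 * μ ^ 2)
  have hs2 : s ^ 2 = (β * μ + ρ) ^ 2 - β ^ 2 * μ ^ 2 :=
    Real.sq_sqrt (by nlinarith [mul_nonneg (mul_pos hβ hμ).le hρ])
  have ha : 0 < β ^ 2 * σ ^ 2 * m := by positivity
  set x₁ := ((β * μ + ρ) - s) / (β ^ 2 * σ ^ 2 * m) with hx₁
  set x₂ := ((β * μ + ρ) + s) / (β ^ 2 * σ ^ 2 * m) with hx₂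
  have hx : x₁ ≤ x₂ := by
    have := Real.sqrt_nonneg ((β * μ + ρ) ^ 2 - β ^ 2 * μ ^ 2)
    exact div_le_div_of_nonneg_right (by linarith) ha.le
  have hquad (x : ℝ) : μ ^ 2 / (2 * σ ^ 2 * m) + (1 / 2) * β ^ 2 * σ ^ 2 * m * x ^ 2
      - (β * μ + ρ) * x = β ^ 2 * σ ^ 2 * m / 2 * ((x - x₁) * (x - x₂)) := by
    rw [hx₁, hx₂]
    field_simp
    linear_combination hs2
  have hfac (t : ℝ) : h t = β ^ 2 * σ ^ 2 * m / 2 *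
      ((Real.exp (r * (T - t)) - x₁) * (Real.exp (r * (T - t)) - x₂)) := by
    rw [hh, ← hquad, ← Real.exp_nat_mul]
    push_cast
    ring_nf
  have hX : β ^ 2 * σ ^ 2 * m / 2 *
      ((Real.exp (r * T) - x₁) * (Real.exp (r * T) - x₂)) < 0 := by
    rw [← hquad]
    have hinv : Real.exp (-(r * T)) * Real.exp (r * T) = 1 := by
      rw [← Real.exp_add, neg_add_cancel, Real.exp_zero]
    have hmul := mul_lt_mul_of_pos_right hcond2 (Real.exp_pos (r * T))
    linear_combination hmul - μ ^ 2 / (2 * σ ^ 2 * m) * hinv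
  have hone : 0 ≤ β ^ 2 * σ ^ 2 * m / 2 * ((1 - x₁) * (1 - x₂)) := by
    rw [← hquad]
    linarith
  obtain ⟨hleast, hbounds⟩ := isLeast_nonneg_quadratic_exp hr hT (half_pos ha) hx hX hone
  simp only [hfac] at ht₂
  rw [hleast.csInf_eq] at ht₂
  exact ⟨ht₂, ht₂ ▸ hbounds⟩
end

section
/- If β·m < μ/σ² < β·m·e^{rT} and ρ ≤ μ²/(2σ²m) + (1/2)β²σ²m - βμ, then t₁ = inf{t ∈ [0,T] : f¹(t) ≥ β} = T - (1/r)·ln(μ/(σ²βm)) ∈ (0,T) and t₂ = inf{t ∈ [t₁,T] : h(t) ≥ 0} = T - (1/r)·ln( ((βμ+ρ) - √((βμ+ρ)² - β²μ²)) / (β²σ²m) ), with t₁ ≤ t₂ ≤ T. -/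
/-- The first time in `[s, T]` at which the decreasing factor `exp (r * (T - t))` is at most `c`. -/
lemma sInf_exp_mul_sub_le {r s T c : ℝ} (hr : 0 < r) (hc : 1 ≤ c)
    (hs : c ≤ Real.exp (r * (T - s))) :
    sInf {t ∈ Set.Icc s T | Real.exp (r * (T - t)) ≤ c} = T - (1 / r) * Real.log c := by
  have hc0 : 0 < c := by linarith
  have hlog : 0 ≤ Real.log c := Real.log_nonneg hc
  have hs' : Real.log c ≤ r * (T - s) := (Real.log_le_iff_le_exp hc0).2 hs
  have hcancel : r * ((1 / r) * Real.log c) = Real.log c := by field_simp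
  refine IsLeast.csInf_eq ⟨⟨⟨?_, ?_⟩, ?_⟩, ?_⟩
  · nlinarith
  · have : 0 ≤ (1 / r) * Real.log c := by positivity
    linarith
  · rw [show r * (T - (T - (1 / r) * Real.log c)) = Real.log c by linear_combination hcancel,
      Real.exp_log hc0]
  · rintro t ⟨-, ht⟩
    have := (Real.le_log_iff_exp_le hc0).2 ht
    nlinarith

/-- For a quadratic with roots `p` and `q`, equal if `x = q`, nonnegativity at `y ≤ x ≤ q` means
`y ≤ p`. -/
lemma mul_sub_nonneg_iff_le {k p q x y : ℝ} (hk : 0 < k) (hq : x ≤ q) (hy : y ≤ x)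
    (hpq : x = q → p = q) :
    0 ≤ k * ((y - p) * (y - q)) ↔ y ≤ p := by
  rw [mul_nonneg_iff_of_pos_left hk]
  constructor
  · intro h
    by_contra! hlt
    have hyq : q ≤ y := by
      by_contra! hyq
      nlinarith [mul_pos (sub_pos.2 hlt) (sub_pos.2 hyq)]
    have := hpq (by linarith)
    linarith
  · intro h
    exact mul_nonneg_of_nonpos_of_nonpos (by linarith) (by linarith)


/-- Case 3: If `βm < μ/σ² < βm·e^{rT}` and
`ρ ≤ μ²/(2σ²m) + (1/2)β²σ²m - βμ`, then `t₁ = T - (1/r)·ln(μ/(σ²βm)) ∈ (0,T)` and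
`t₂ = T - (1/r)·ln(((βμ+ρ) - √((βμ+ρ)² - β²μ²))/(β²σ²m))` with `t₁ ≤ t₂ ≤ T`. -/
theorem stmt_16
    (r μ σ m β T ρ : ℝ)
    (hr : 0 < r) (hμ : 0 < μ) (hσ : 0 < σ) (hm : 0 < m) (hβ : 0 < β) (hT : 0 < T)
    (hρ : 0 ≤ ρ)
    (f1 h : ℝ → ℝ)
    (hf1 : ∀ t, f1 t = (μ / (σ ^ 2 * m)) * Real.exp (-(r * (T - t))))
    (hh : ∀ t, h t = μ ^ 2 / (2 * σ ^ 2 * m)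
      + (1 / 2) * β ^ 2 * σ ^ 2 * m * Real.exp (2 * r * (T - t))
      - (β * μ + ρ) * Real.exp (r * (T - t)))
    (hcond1 : β * m < μ / σ ^ 2)
    (hcond2 : μ / σ ^ 2 < β * m * Real.exp (r * T))
    (hcond3 : ρ ≤ μ ^ 2 / (2 * σ ^ 2 * m) + (1 / 2) * β ^ 2 * σ ^ 2 * m - β * μ)
    (t₁ : ℝ) (ht₁ : t₁ = sInf {t ∈ Set.Icc (0 : ℝ) T | β ≤ f1 t})
    (t₂ : ℝ) (ht₂ : t₂ = sInf {t ∈ Set.Icc t₁ T | 0 ≤ h t}) :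
    t₁ = T - (1 / r) * Real.log (μ / (σ ^ 2 * β * m)) ∧
    t₁ ∈ Set.Ioo (0 : ℝ) T ∧
    t₂ = T - (1 / r) * Real.log (((β * μ + ρ)
      - Real.sqrt ((β * μ + ρ) ^ 2 - β ^ 2 * μ ^ 2)) / (β ^ 2 * σ ^ 2 * m)) ∧
    t₁ ≤ t₂ ∧ t₂ ≤ T := by
  set x := μ / (σ ^ 2 * β * m) with hx
  set S := Real.sqrt ((β * μ + ρ) ^ 2 - β ^ 2 * μ ^ 2) with hS
  have hS0 : 0 ≤ S := Real.sqrt_nonneg _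
  have hβμ : 0 < β * μ := by positivity
  have hSsq : S ^ 2 = (β * μ + ρ) ^ 2 - β ^ 2 * μ ^ 2 :=
    Real.sq_sqrt (by nlinarith [mul_nonneg hβμ.le hρ])
  have hd : 0 < β ^ 2 * σ ^ 2 * m := by positivity
  set p := ((β * μ + ρ) - S) / (β ^ 2 * σ ^ 2 * m) with hp
  set q := ((β * μ + ρ) + S) / (β ^ 2 * σ ^ 2 * m) with hq
  have hxd : x = β * μ / (β ^ 2 * σ ^ 2 * m) := by rw [hx]; field_simp
  have hβm : 0 < β * m := by positivity
  have hxdiv : x = μ / σ ^ 2 / (β * m) := by rw [hx]; field_simp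
  have hx1 : 1 < x := by rw [hxdiv, one_lt_div hβm]; exact hcond1
  have hxT : x < Real.exp (r * T) := by
    rw [hxdiv, div_lt_iff₀ hβm]; linarith
  have hρS : ρ ≤ S := abs_le_of_sq_le_sq' (by nlinarith [mul_nonneg hβμ.le hρ]) hS0 |>.2
  have hpx : p ≤ x := by
    rw [hp, hxd]; gcongr; linarith
  have hxq : x ≤ q := by
    rw [hq, hxd]; gcongr; linarith
  have hpq : x = q → p = q := by
    intro hxq'
    rw [hxd, hq, div_left_inj' hd.ne'] at hxq'
    have : S = 0 := by linarith
    rw [hp, hq, this]; ring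
  have hfactor : ∀ y : ℝ, μ ^ 2 / (2 * σ ^ 2 * m) + (1 / 2) * β ^ 2 * σ ^ 2 * m * y ^ 2
      - (β * μ + ρ) * y = (β ^ 2 * σ ^ 2 * m / 2) * ((y - p) * (y - q)) := by
    intro y
    have hprod : p * q = μ ^ 2 / (β ^ 2 * (σ ^ 2 * m) ^ 2) := by
      rw [hp, hq, div_mul_div_comm,
        show (β * μ + ρ - S) * (β * μ + ρ + S) = β ^ 2 * μ ^ 2 by linear_combination -hSsq]
      field_simp
    have hsum : (β ^ 2 * σ ^ 2 * m) * (p + q) = 2 * (β * μ + ρ) := by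
      rw [hp, hq]; field_simp; ring
    have hprod' : (β ^ 2 * σ ^ 2 * m / 2) * (p * q) = μ ^ 2 / (2 * σ ^ 2 * m) := by
      rw [hprod]; field_simp
    linear_combination -hprod' + y / 2 * hsum
  have hk : 0 < β ^ 2 * σ ^ 2 * m / 2 := by positivity
  have hp1 : 1 ≤ p := by
    rw [← mul_sub_nonneg_iff_le hk hxq hx1.le hpq, ← hfactor]
    linarith
  have hf_iff : ∀ t, β ≤ f1 t ↔ Real.exp (r * (T - t)) ≤ x := by
    intro t
    have hE := Real.exp_pos (r * (T - t))
    rw [hf1, Real.exp_neg, ← div_eq_mul_inv, le_div_iff₀ hE, ← le_div_iff₀' hβ,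
      show μ / (σ ^ 2 * m) / β = x by rw [hx]; field_simp]
  have ht₁' : t₁ = T - (1 / r) * Real.log x := by
    simp only [ht₁, hf_iff]
    exact sInf_exp_mul_sub_le hr hx1.le (by simpa using hxT.le)
  have hexp : Real.exp (r * (T - t₁)) = x := by
    rw [ht₁', show r * (T - (T - (1 / r) * Real.log x)) = Real.log x by field_simp; ring,
      Real.exp_log (by linarith)]
  have hh_iff : ∀ t, t₁ ≤ t → (0 ≤ h t ↔ Real.exp (r * (T - t)) ≤ p) := by
    intro t ht
    have hy : Real.exp (r * (T - t)) ≤ x := by rw [← hexp]; gcongr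
    rw [← mul_sub_nonneg_iff_le hk hxq hy hpq, ← hfactor, hh, ← Real.exp_nat_mul]
    norm_num [mul_assoc]
  have hset : {t ∈ Set.Icc t₁ T | 0 ≤ h t} =
      {t ∈ Set.Icc t₁ T | Real.exp (r * (T - t)) ≤ p} :=
    Set.ext fun t => and_congr_right fun ht => hh_iff t ht.1
  have ht₂' : t₂ = T - (1 / r) * Real.log p := by
    rw [ht₂, hset]
    exact sInf_exp_mul_sub_le hr hp1 (by rw [hexp]; exact hpx)
  have hlogx : 0 < Real.log x := Real.log_pos hx1
  have hlogp : 0 ≤ Real.log p := Real.log_nonneg hp1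
  have hlogT : (1 / r) * Real.log x < T := by
    rw [one_div, inv_mul_lt_iff₀ hr]
    exact (Real.log_lt_iff_lt_exp (by linarith)).2 hxT
  refine ⟨ht₁', ⟨by linarith, ?_⟩, ht₂', ?_, ?_⟩
  · have : 0 < (1 / r) * Real.log x := by positivity
    linarith
  · rw [ht₁', ht₂']
    gcongr
  · have : 0 ≤ (1 / r) * Real.log p := by positivity
    linarith
end

section
/- For every ρ > 0, the map β ↦ T - (1/r)·ln( ((βμ+ρ) - √((βμ+ρ)² - β²μ²)) / (β²σ²m) ) is strictly increasing on (0,∞); equivalently, the map β ↦ (βμ+ρ) + √((βμ+ρ)² - β²μ²) is strictly increasing on (0,∞). -/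
/-- The conjugate `(βμ+ρ) + √((βμ+ρ)² - β²μ²)` is strictly increasing in `β > 0`. -/
theorem strictMonoOn_add_sqrt_sq_sub {μ ρ : ℝ} (hμ : 0 < μ) (hρ : 0 < ρ) :
    StrictMonoOn (fun β : ℝ => (β * μ + ρ)
      + Real.sqrt ((β * μ + ρ) ^ 2 - β ^ 2 * μ ^ 2)) (Set.Ioi 0) := by
  intro a _ b _ hab
  have hlt : a * μ < b * μ := mul_lt_mul_of_pos_right hab hμ
  have hsqrt : Real.sqrt ((a * μ + ρ) ^ 2 - a ^ 2 * μ ^ 2)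
      ≤ Real.sqrt ((b * μ + ρ) ^ 2 - b ^ 2 * μ ^ 2) :=
    Real.sqrt_le_sqrt (by nlinarith [mul_lt_mul_of_pos_right hlt hρ])
  exact add_lt_add_of_lt_of_le (by linarith) hsqrt

/-- Rationalizing the numerator of the argument of the logarithm. -/
theorem sub_sqrt_sq_sub_div_eq {μ σ m ρ β : ℝ} (hμ : 0 < μ) (hσ : 0 < σ) (hm : 0 < m)
    (hρ : 0 < ρ) (hβ : 0 < β) :
    ((β * μ + ρ) - Real.sqrt ((β * μ + ρ) ^ 2 - β ^ 2 * μ ^ 2)) / (β ^ 2 * σ ^ 2 * m)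
      = μ ^ 2 / (σ ^ 2 * m *
        ((β * μ + ρ) + Real.sqrt ((β * μ + ρ) ^ 2 - β ^ 2 * μ ^ 2))) := by
  have hβμ : 0 < β * μ := mul_pos hβ hμ
  have hsq : Real.sqrt ((β * μ + ρ) ^ 2 - β ^ 2 * μ ^ 2) ^ 2
      = (β * μ + ρ) ^ 2 - β ^ 2 * μ ^ 2 :=
    Real.sq_sqrt (by nlinarith [mul_pos hβμ hρ])
  have hnonneg := Real.sqrt_nonneg ((β * μ + ρ) ^ 2 - β ^ 2 * μ ^ 2)
  generalize Real.sqrt ((β * μ + ρ) ^ 2 - β ^ 2 * μ ^ 2) = s at hsq hnonneg ⊢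
  rw [div_eq_div_iff (by positivity) (by positivity)]
  linear_combination (-(σ ^ 2 * m)) * hsq

/-- For every `ρ > 0`, the optimal expansion time
`β ↦ T - (1/r)·ln(((βμ+ρ) - √((βμ+ρ)² - β²μ²))/(β²σ²m))` is strictly increasing in the
pre-expansion trading limit `β` on `(0,∞)`; equivalently,
`β ↦ (βμ+ρ) + √((βμ+ρ)² - β²μ²)` is strictly increasing on `(0,∞)`. -/
theorem stmt_18
    (r μ σ m T ρ : ℝ)
    (hr : 0 < r) (hμ : 0 < μ) (hσ : 0 < σ) (hm : 0 < m) (hT : 0 < T) (hρ : 0 < ρ) :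
    StrictMonoOn (fun β : ℝ => T - (1 / r) * Real.log (((β * μ + ρ)
      - Real.sqrt ((β * μ + ρ) ^ 2 - β ^ 2 * μ ^ 2)) / (β ^ 2 * σ ^ 2 * m)))
      (Set.Ioi 0) ∧
    StrictMonoOn (fun β : ℝ => (β * μ + ρ)
      + Real.sqrt ((β * μ + ρ) ^ 2 - β ^ 2 * μ ^ 2)) (Set.Ioi 0) := by
  have hmono := strictMonoOn_add_sqrt_sq_sub hμ hρ
  refine ⟨fun a ha b hb hab => ?_, hmono⟩
  have hconj := hmono ha hb hab
  rw [Set.mem_Ioi] at ha hb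
  beta_reduce at hconj ⊢
  rw [sub_sqrt_sq_sub_div_eq hμ hσ hm hρ ha, sub_sqrt_sq_sub_div_eq hμ hσ hm hρ hb]
  gcongr
end
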